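/- Let c be a 1-cochain of the form c(X_h, F)(x) = Σ_α U_α(x) h(x) F^{(α)}(x) + Σ_α V_α(x) h′(x) F^{(α)}(x) + Σ_α W_α(x) h″(x) F^{(α)}(x), where (U_α), (V_α), (W_α) are finitely supported families of smooth functions ℝ → ℝ. If c satisfies the 1-cocycle condition, then there exist a finitely supported family (D_α) of smooth functions and finitely supported families of real constants (B_α), (C_α) satisfying 2(δ − |α| − 1) C_α + Σ_{i=1}^n (α_i + 1)(α_i + 2λ_i) B_{α^i} = 0 for all α ∈ ℕⁿ, such that for every polynomial h of degree ≤ 2, all smooth F and all x: c(X_h, F)(x) − ∂b(X_h, F)(x) = Σ_α B_α h′(x) F^{(α)}(x) + Σ_α C_α h″(x) F^{(α)}(x), where b(F) = Σ_α D_α F^{(α)}. -/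

import Mathlib

open scoped BigOperators

noncomputable section

/-- `h` is (the coefficient of) an element of `sl(2)`: a polynomial of degree ≤ 2. -/
def IsSl2 (h : ℝ → ℝ) : Prop := ∃ a b c : ℝ, h = fun x => a + b * x + c * x ^ 2

/-- `F^{(α)}(x) = f₁^{(α₁)}(x) ⋯ f_n^{(α_n)}(x)`. -/
def Fder (n : ℕ) (F : Fin n → ℝ → ℝ) (α : Fin n → ℕ) (x : ℝ) : ℝ :=
  ∏ i, iteratedDeriv (α i) (F i) x

/-- The multilinear differential operator `b(F) = Σ_α D_α F^{(α)}` associated with a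
finitely supported family of coefficient functions `D`. -/
def opOf (n : ℕ) (D : (Fin n → ℕ) → ℝ → ℝ) (F : Fin n → ℝ → ℝ) (x : ℝ) : ℝ :=
  ∑ᶠ α : Fin n → ℕ, D α x * Fder n F α x

/-- The sl(2)-action `(X_h · A)(F) = h (A F)' + μ h' (A F) − Σᵢ A(f₁,…, h fᵢ' + λᵢ h' fᵢ, …, f_n)`
of `X_h` on a multilinear operator `A`. -/
def act (n : ℕ) (lam : Fin n → ℝ) (μ : ℝ) (A : (Fin n → ℝ → ℝ) → ℝ → ℝ)
    (h : ℝ → ℝ) (F : Fin n → ℝ → ℝ) (x : ℝ) : ℝ :=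
  h x * deriv (A F) x + μ * deriv h x * A F x
    - ∑ i, A (Function.update F i (fun y => h y * deriv (F i) y + lam i * deriv h y * F i y)) x

/-- The coboundary `∂b(X_h, F)` of the operator `b` with coefficients `D`. -/
def cobound (n : ℕ) (lam : Fin n → ℝ) (μ : ℝ) (D : (Fin n → ℕ) → ℝ → ℝ)
    (h : ℝ → ℝ) (F : Fin n → ℝ → ℝ) (x : ℝ) : ℝ :=
  act n lam μ (fun G y => opOf n D G y) h F x


/-- The 1-cocycle condition for a 1-cochain `c` on sl(2) with values in `D_{λ,μ}`. -/
def IsCocycle (n : ℕ) (lam : Fin n → ℝ) (μ : ℝ)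
    (c : (ℝ → ℝ) → (Fin n → ℝ → ℝ) → ℝ → ℝ) : Prop :=
  ∀ h₁ h₂ : ℝ → ℝ, IsSl2 h₁ → IsSl2 h₂ →
    ∀ F : Fin n → ℝ → ℝ, (∀ i, ContDiff ℝ (⊤ : ℕ∞) (F i)) → ∀ x : ℝ,
      c (fun y => h₁ y * deriv h₂ y - deriv h₁ y * h₂ y) F x
        = act n lam μ (c h₂) h₁ F x - act n lam μ (c h₁) h₂ F x

/-- quadratic polynomial -/
def qd (a b c : ℝ) : ℝ → ℝ := fun x => a + b * x + c * x ^ 2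

lemma qd_hasDerivAt (a b c x : ℝ) : HasDerivAt (qd a b c) (b + 2 * c * x) x := by
  have h := (((hasDerivAt_id x).const_mul b).const_add a).add (((hasDerivAt_id x).pow 2).const_mul c)
  refine h.congr_deriv ?_
  simp only [id]
  norm_num
  ring

lemma deriv_qd (a b c : ℝ) : deriv (qd a b c) = qd b (2 * c) 0 := by
  funext x
  rw [(qd_hasDerivAt a b c x).deriv]
  simp [qd]

lemma deriv_deriv_qd (a b c : ℝ) : deriv (deriv (qd a b c)) = fun _ => 2 * c := by
  rw [deriv_qd, deriv_qd]
  funext x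
  simp [qd]

lemma iter_hasDerivAt (f : ℝ → ℝ) (hf : ContDiff ℝ (⊤ : ℕ∞) f) (k : ℕ) (x : ℝ) :
    HasDerivAt (iteratedDeriv k f) (iteratedDeriv (k + 1) f x) x := by
  rw [iteratedDeriv_succ]
  apply DifferentiableAt.hasDerivAt
  exact (hf.differentiable_iteratedDeriv k (by exact_mod_cast ENat.natCast_lt_top k)) x

lemma iter_act (f : ℝ → ℝ) (hf : ContDiff ℝ (⊤ : ℕ∞) f) (a b c l : ℝ) (k : ℕ) :
    iteratedDeriv k (fun y => qd a b c y * deriv f y + l * deriv (qd a b c) y * f y)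
      = fun x => qd a b c x * iteratedDeriv (k + 1) f x
        + (k + l) * qd b (2 * c) 0 x * iteratedDeriv k f x
        + c * (k * (k - 1 + 2 * l)) * iteratedDeriv (k - 1) f x := by
  induction k with
  | zero =>
    funext x
    simp [deriv_qd, iteratedDeriv_one]
  | succ k ih =>
    rw [iteratedDeriv_succ, ih]
    funext x
    have h1 := (qd_hasDerivAt a b c x).mul (iter_hasDerivAt f hf (k + 1) x)
    have h2 := ((qd_hasDerivAt b (2 * c) 0 x).const_mul ((k : ℝ) + l)).mul (iter_hasDerivAt f hf k x)
    have h3 : HasDerivAt (fun x => c * (k * (k - 1 + 2 * l)) * iteratedDeriv (k - 1) f x)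
        (c * (k * (k - 1 + 2 * l)) * iteratedDeriv k f x) x := by
      rcases k with _ | k
      · simpa using hasDerivAt_const x (0 : ℝ)
      · exact (iter_hasDerivAt f hf k x).const_mul _
    have h := ((h1.add h2).add h3).deriv
    refine Eq.trans h ?_
    simp only [qd, Nat.add_sub_cancel]
    push_cast
    ring

/-- product over the other indices -/
def Rst (n : ℕ) (F : Fin n → ℝ → ℝ) (α : Fin n → ℕ) (i : Fin n) (x : ℝ) : ℝ :=
  ∏ j ∈ Finset.univ.erase i, iteratedDeriv (α j) (F j) x

lemma Fder_split (n : ℕ) (F : Fin n → ℝ → ℝ) (α : Fin n → ℕ) (i : Fin n) (x : ℝ) :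
    Fder n F α x = iteratedDeriv (α i) (F i) x * Rst n F α i x := by
  unfold Fder Rst
  rw [Finset.mul_prod_erase _ (fun j => iteratedDeriv (α j) (F j) x) (Finset.mem_univ i)]

lemma Fder_updF (n : ℕ) (F : Fin n → ℝ → ℝ) (α : Fin n → ℕ) (i : Fin n) (x : ℝ) (g : ℝ → ℝ) :
    Fder n (Function.update F i g) α x = iteratedDeriv (α i) g x * Rst n F α i x := by
  rw [Fder_split n _ α i]
  unfold Rst
  rw [Function.update_self]
  congr 1
  apply Finset.prod_congr rfl
  intro j hj
  rw [Function.update_of_ne (Finset.ne_of_mem_erase hj)]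

lemma Fder_updA (n : ℕ) (F : Fin n → ℝ → ℝ) (α : Fin n → ℕ) (i : Fin n) (x : ℝ) (k : ℕ) :
    Fder n F (Function.update α i k) x = iteratedDeriv k (F i) x * Rst n F α i x := by
  rw [Fder_split n _ _ i]
  unfold Rst
  rw [Function.update_self]
  congr 1
  apply Finset.prod_congr rfl
  intro j hj
  rw [Function.update_of_ne (Finset.ne_of_mem_erase hj)]

lemma Fder_hasDerivAt (n : ℕ) (F : Fin n → ℝ → ℝ) (hF : ∀ i, ContDiff ℝ (⊤ : ℕ∞) (F i))
    (α : Fin n → ℕ) (x : ℝ) :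
    HasDerivAt (Fder n F α) (∑ i, Fder n F (Function.update α i (α i + 1)) x) x := by
  have h := HasDerivAt.fun_finsetProd (u := Finset.univ) (x := x)
    (f := fun i => iteratedDeriv (α i) (F i))
    (f' := fun i => iteratedDeriv (α i + 1) (F i) x)
    (fun i _ => iter_hasDerivAt (F i) (hF i) (α i) x)
  refine h.congr_deriv ?_
  apply Finset.sum_congr rfl
  intro i _
  rw [Fder_updA, smul_eq_mul, mul_comm]
  rfl

/-- single-term action -/
lemma act_single (n : ℕ) (lam : Fin n → ℝ) (μ : ℝ) (a b c : ℝ) (F : Fin n → ℝ → ℝ)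
    (hF : ∀ i, ContDiff ℝ (⊤ : ℕ∞) (F i)) (α : Fin n → ℕ) (p : ℝ → ℝ)
    (hp : ContDiff ℝ (⊤ : ℕ∞) p) (x : ℝ) :
    act n lam μ (fun G y => p y * Fder n G α y) (qd a b c) F x
      = (qd a b c x * deriv p x
          + ((μ - ∑ i, lam i) - ∑ i, (α i : ℝ)) * qd b (2 * c) 0 x * p x) * Fder n F α x
        - ∑ i, c * (α i * (α i - 1 + 2 * lam i)) * p x
            * Fder n F (Function.update α i (α i - 1)) x := by
  unfold act
  have hd : HasDerivAt p (deriv p x) x := (hp.differentiable (by simp) x).hasDerivAt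
  have h1 := (hd.mul (Fder_hasDerivAt n F hF α x)).deriv
  have h1b : deriv (fun y => p y * Fder n F α y) x = _ := h1
  rw [h1b]
  have h2 : ∀ i, p x * Fder n (Function.update F i
      (fun y => qd a b c y * deriv (F i) y + lam i * deriv (qd a b c) y * F i y)) α x
      = qd a b c x * p x * Fder n F (Function.update α i (α i + 1)) x
       + ((α i : ℝ) + lam i) * (qd b (2 * c) 0 x * p x * Fder n F α x)
       + c * (α i * (α i - 1 + 2 * lam i)) * p x
            * Fder n F (Function.update α i (α i - 1)) x := by
    intro i
    rw [Fder_updF, iter_act _ (hF i), Fder_updA, Fder_updA, Fder_split n F α i]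
    ring
  rw [Finset.sum_congr rfl (fun i _ => h2 i)]
  simp only [Finset.sum_add_distrib, ← Finset.mul_sum, ← Finset.sum_mul, deriv_qd]
  ring

/-- finitely supported smooth families -/
structure Good (n : ℕ) (P : (Fin n → ℕ) → ℝ → ℝ) : Prop where
  fin : {α | P α ≠ 0}.Finite
  smooth : ∀ α, ContDiff ℝ (⊤ : ℕ∞) (P α)

lemma opOf_sum (n : ℕ) (P : (Fin n → ℕ) → ℝ → ℝ) (S : Finset (Fin n → ℕ))
    (hS : ∀ α, α ∉ S → P α = 0) (F : Fin n → ℝ → ℝ) (x : ℝ) :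
    opOf n P F x = ∑ α ∈ S, P α x * Fder n F α x := by
  unfold opOf
  apply finsum_eq_sum_of_support_subset
  intro α hα
  by_contra h
  apply hα
  simp [hS α h]

lemma Good.exS {n : ℕ} {P : (Fin n → ℕ) → ℝ → ℝ} (h : Good n P) :
    ∃ S : Finset (Fin n → ℕ), ∀ α, α ∉ S → P α = 0 := by
  refine ⟨h.fin.toFinset, fun α hα => ?_⟩
  simpa using hα

lemma Good.of_S {n : ℕ} {P : (Fin n → ℕ) → ℝ → ℝ} (S : Finset (Fin n → ℕ))
    (h : ∀ α, α ∉ S → P α = 0) : {α | P α ≠ 0}.Finite := by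
  refine S.finite_toSet.subset fun α hα => ?_
  by_contra hcon
  exact hα (h α hcon)

/-- lowering operator -/
def LL (n : ℕ) (lam : Fin n → ℝ) (P : (Fin n → ℕ) → ℝ → ℝ) (α : Fin n → ℕ) (x : ℝ) : ℝ :=
  ∑ i, ((α i : ℝ) + 1) * ((α i : ℝ) + 2 * lam i) * P (Function.update α i (α i + 1)) x

lemma raise_inj (n : ℕ) (i : Fin n) :
    Function.Injective (fun α : Fin n → ℕ => Function.update α i (α i + 1)) := by
  intro α β h
  funext j
  have := congrFun h j
  by_cases hj : j = i
  · subst hj; simpa using this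
  · simpa [Function.update_of_ne hj] using this

lemma fin_raise (n : ℕ) (i : Fin n) {P : (Fin n → ℕ) → ℝ → ℝ} (h : {α | P α ≠ 0}.Finite) :
    {α : Fin n → ℕ | P (Function.update α i (α i + 1)) ≠ 0}.Finite :=
  h.preimage (raise_inj n i).injOn

lemma reindex (n : ℕ) (lam : Fin n → ℝ) (P : (Fin n → ℕ) → ℝ → ℝ)
    (F : Fin n → ℝ → ℝ) (x : ℝ) (i : Fin n) :
    ∑ᶠ α : Fin n → ℕ, ((α i : ℝ) * (α i - 1 + 2 * lam i)) * P α x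
        * Fder n F (Function.update α i (α i - 1)) x
      = ∑ᶠ α : Fin n → ℕ, (((α i : ℝ) + 1) * (α i + 2 * lam i)
          * P (Function.update α i (α i + 1)) x) * Fder n F α x := by
  have h := finsum_mem_range (f := fun α : Fin n → ℕ => ((α i : ℝ) * (α i - 1 + 2 * lam i)) * P α x
        * Fder n F (Function.update α i (α i - 1)) x) (raise_inj n i)
  have h2 : ∀ α : Fin n → ℕ, α ∉ Set.range (fun α : Fin n → ℕ => Function.update α i (α i + 1)) →
      ((α i : ℝ) * (α i - 1 + 2 * lam i)) * P α x
        * Fder n F (Function.update α i (α i - 1)) x = 0 := by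
    intro α hα
    have : α i = 0 := by
      by_contra h0
      apply hα
      refine ⟨Function.update α i (α i - 1), ?_⟩
      simp only [Function.update_self, Function.update_idem]
      rw [Nat.sub_add_cancel (Nat.one_le_iff_ne_zero.mpr h0), Function.update_eq_self]
    simp [this]
  rw [← finsum_mem_univ, ← finsum_mem_inter_support, Set.univ_inter]
  rw [← finsum_mem_inter_support] at h
  rw [Set.inter_eq_self_of_subset_right] at h
  · rw [h]
    apply finsum_congr
    intro α
    simp only [Function.update_self, Function.update_idem, Nat.add_sub_cancel,
      Function.update_eq_self]
    push_cast
    ring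
  · intro α hα
    by_contra hcon
    exact hα (h2 α hcon)

/-- action on coefficients -/
def QQ (n : ℕ) (lam : Fin n → ℝ) (μ a b c : ℝ) (P : (Fin n → ℕ) → ℝ → ℝ)
    (α : Fin n → ℕ) (x : ℝ) : ℝ :=
  qd a b c x * deriv (P α) x
    + ((μ - ∑ i, lam i) - ∑ i, (α i : ℝ)) * qd b (2 * c) 0 x * P α x - c * LL n lam P α x

lemma act_sum (n : ℕ) (lam : Fin n → ℝ) (μ : ℝ) {ι : Type*} (S : Finset ι)
    (A : ι → (Fin n → ℝ → ℝ) → ℝ → ℝ) (h : ℝ → ℝ) (F : Fin n → ℝ → ℝ) (x : ℝ)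
    (hA : ∀ s ∈ S, DifferentiableAt ℝ (A s F) x) :
    act n lam μ (fun G y => ∑ s ∈ S, A s G y) h F x = ∑ s ∈ S, act n lam μ (A s) h F x := by
  unfold act
  have : deriv (fun y => ∑ s ∈ S, A s F y) x = ∑ s ∈ S, deriv (A s F) x := deriv_fun_sum hA
  rw [this, Finset.sum_comm, Finset.mul_sum, Finset.mul_sum, ← Finset.sum_add_distrib,
    ← Finset.sum_sub_distrib]

lemma LL_fin (n : ℕ) (lam : Fin n → ℝ) {P : (Fin n → ℕ) → ℝ → ℝ} (h : {α | P α ≠ 0}.Finite) :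
    {α | LL n lam P α ≠ 0}.Finite := by
  refine (Set.finite_iUnion (fun i => fin_raise n i h)).subset fun α hα => ?_
  by_contra hcon
  simp only [Set.mem_iUnion, Set.mem_ofPred_eq, not_exists, not_not] at hcon
  apply hα
  funext x
  simp [LL, hcon]

lemma QQ_fin (n : ℕ) (lam : Fin n → ℝ) (μ a b c : ℝ) {P : (Fin n → ℕ) → ℝ → ℝ}
    (h : {α | P α ≠ 0}.Finite) : {α | QQ n lam μ a b c P α ≠ 0}.Finite := by
  refine (h.union (LL_fin n lam h)).subset fun α hα => ?_
  by_contra hcon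
  simp only [Set.mem_union, Set.mem_ofPred_eq, not_or, not_not] at hcon
  apply hα
  funext x
  have := hcon.2
  simp [QQ, hcon.1, hcon.2]

lemma supp_fin {n : ℕ} {P : (Fin n → ℕ) → ℝ → ℝ} (h : {α | P α ≠ 0}.Finite)
    (x : ℝ) (G : (Fin n → ℕ) → ℝ) : (Function.support fun α => P α x * G α).Finite := by
  refine h.subset fun α hα => ?_
  by_contra hcon
  simp only [Set.mem_ofPred_eq, not_not] at hcon
  apply hα
  simp [hcon]

lemma opOf_sub (n : ℕ) {P Q : (Fin n → ℕ) → ℝ → ℝ} (hP : {α | P α ≠ 0}.Finite)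
    (hQ : {α | Q α ≠ 0}.Finite) (F : Fin n → ℝ → ℝ) (x : ℝ) :
    opOf n (fun α x => P α x - Q α x) F x = opOf n P F x - opOf n Q F x := by
  unfold opOf
  rw [← finsum_sub_distrib (supp_fin hP x _) (supp_fin hQ x _)]
  simp only [sub_mul]

lemma opOf_add (n : ℕ) {P Q : (Fin n → ℕ) → ℝ → ℝ} (hP : {α | P α ≠ 0}.Finite)
    (hQ : {α | Q α ≠ 0}.Finite) (F : Fin n → ℝ → ℝ) (x : ℝ) :
    opOf n (fun α x => P α x + Q α x) F x = opOf n P F x + opOf n Q F x := by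
  unfold opOf
  rw [← finsum_add_distrib (supp_fin hP x _) (supp_fin hQ x _)]
  simp only [add_mul]

lemma opOf_LL (n : ℕ) (lam : Fin n → ℝ) {P : (Fin n → ℕ) → ℝ → ℝ} (hP : {α | P α ≠ 0}.Finite)
    (S : Finset (Fin n → ℕ)) (hS : ∀ α, α ∉ S → P α = 0) (F : Fin n → ℝ → ℝ) (x : ℝ) :
    opOf n (LL n lam P) F x = ∑ α ∈ S, ∑ i, ((α i : ℝ) * (α i - 1 + 2 * lam i)) * P α x
        * Fder n F (Function.update α i (α i - 1)) x := by
  unfold opOf LL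
  simp only [Finset.sum_mul]
  rw [finsum_sum_comm, Finset.sum_comm]
  · apply Finset.sum_congr rfl
    intro i _
    rw [← reindex]
    apply finsum_eq_sum_of_support_subset
    intro α hα
    by_contra h
    apply hα
    simp [hS α h]
  · intro i _
    refine (fin_raise n i hP).subset fun α hα => ?_
    by_contra hcon
    simp only [Set.mem_ofPred_eq, not_not] at hcon
    apply hα
    simp [hcon]

lemma act_opOf (n : ℕ) (lam : Fin n → ℝ) (μ a b c : ℝ) {P : (Fin n → ℕ) → ℝ → ℝ} (hP : Good n P)
    (F : Fin n → ℝ → ℝ) (hF : ∀ i, ContDiff ℝ (⊤ : ℕ∞) (F i)) (x : ℝ) :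
    act n lam μ (fun G y => opOf n P G y) (qd a b c) F x
      = opOf n (QQ n lam μ a b c P) F x := by
  obtain ⟨S, hS⟩ := hP.exS
  have e1 : (fun G y => opOf n P G y) = fun G y => ∑ α ∈ S, P α y * Fder n G α y := by
    funext G y; exact opOf_sum n P S hS G y
  rw [e1, act_sum n lam μ S (fun α G y => P α y * Fder n G α y)]
  · simp only [act_single n lam μ a b c F hF _ _ (hP.smooth _)]
    rw [Finset.sum_sub_distrib]
    have e2 := opOf_sub n (P := fun α x => qd a b c x * deriv (P α) x
        + ((μ - ∑ i, lam i) - ∑ i, (α i : ℝ)) * qd b (2 * c) 0 x * P α x)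
        (Q := fun α x => c * LL n lam P α x)
        (Good.of_S S fun α hα => by funext y; simp [hS α hα])
        ((LL_fin n lam hP.fin).subset fun α hα => by
          intro h0
          apply hα
          funext y
          simp [h0]) F x
    have e3 : opOf n (fun α x => c * LL n lam P α x) F x = c * opOf n (LL n lam P) F x := by
      unfold opOf
      rw [mul_finsum]
      simp only [mul_assoc]
    refine Eq.trans ?_ e2.symm
    rw [e3, opOf_LL n lam hP.fin S hS,
      opOf_sum n _ S (fun α hα => by funext y; simp [hS α hα])]
    congr 1
    simp only [Finset.mul_sum]
    apply Finset.sum_congr rfl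
    intro α _
    apply Finset.sum_congr rfl
    intro i _
    ring
  · intro α _
    exact ((hP.smooth α).differentiable (by simp) x).mul
      (Fder_hasDerivAt n F hF α x).differentiableAt

/-- test function -/
lemma iter_test (x : ℝ) (k m : ℕ) :
    iteratedDeriv m (fun y : ℝ => (y - x) ^ k) x = if m = k then (k.factorial : ℝ) else 0 := by
  have h := iteratedDeriv_comp_sub_const m (fun y : ℝ => y ^ k) x
  rw [h]
  simp only [sub_self]
  rw [iteratedDeriv_fun_pow_zero]
  split_ifs <;> simp

lemma coeff_unique (n : ℕ) {P Q : (Fin n → ℕ) → ℝ → ℝ} (x : ℝ)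
    (h : ∀ F : Fin n → ℝ → ℝ, (∀ i, ContDiff ℝ (⊤ : ℕ∞) (F i)) → opOf n P F x = opOf n Q F x)
    (α : Fin n → ℕ) : P α x = Q α x := by
  have h1 := h (fun i y => (y - x) ^ (α i)) (fun i => by fun_prop)
  have h2 : ∀ β, β ≠ α → Fder n (fun i y => (y - x) ^ (α i)) β x = 0 := by
    intro β hβ
    obtain ⟨i, hi⟩ := Function.ne_iff.mp hβ
    exact Finset.prod_eq_zero (Finset.mem_univ i) (by rw [iter_test, if_neg hi])
  have h3 : Fder n (fun i y => (y - x) ^ (α i)) α x ≠ 0 := by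
    refine Finset.prod_ne_zero_iff.mpr fun i _ => ?_
    rw [iter_test, if_pos rfl]
    exact_mod_cast Nat.factorial_ne_zero _
  unfold opOf at h1
  rw [finsum_eq_single _ α (fun β hβ => by rw [h2 β hβ, mul_zero]),
    finsum_eq_single _ α (fun β hβ => by rw [h2 β hβ, mul_zero])] at h1
  exact mul_right_cancel₀ h3 h1

/-- coefficients of the cochain -/
def PP (n : ℕ) (U V W : (Fin n → ℕ) → ℝ → ℝ) (a b c : ℝ) (α : Fin n → ℕ) (x : ℝ) : ℝ :=
  U α x * qd a b c x + V α x * qd b (2 * c) 0 x + W α x * (2 * c)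

lemma PP_good (n : ℕ) {U V W : (Fin n → ℕ) → ℝ → ℝ} (hU : Good n U) (hV : Good n V)
    (hW : Good n W) (a b c : ℝ) : Good n (PP n U V W a b c) := by
  refine ⟨?_, fun α => ?_⟩
  · refine ((hU.fin.union hV.fin).union hW.fin).subset fun α hα => ?_
    by_contra hcon
    simp only [Set.mem_union, Set.mem_ofPred_eq, not_or, not_not] at hcon
    apply hα
    funext x
    simp [PP, hcon.1.1, hcon.1.2, hcon.2]
  · have h1 := hU.smooth α
    have h2 := hV.smooth α
    have h3 := hW.smooth α
    unfold PP qd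
    fun_prop

lemma c_opOf (n : ℕ) {U V W : (Fin n → ℕ) → ℝ → ℝ} (hU : {α | U α ≠ 0}.Finite)
    (hV : {α | V α ≠ 0}.Finite) (hW : {α | W α ≠ 0}.Finite) (a b c : ℝ)
    (F : Fin n → ℝ → ℝ) (x : ℝ) :
    (∑ᶠ α : Fin n → ℕ, U α x * qd a b c x * Fder n F α x)
        + (∑ᶠ α : Fin n → ℕ, V α x * deriv (qd a b c) x * Fder n F α x)
        + (∑ᶠ α : Fin n → ℕ, W α x * deriv (deriv (qd a b c)) x * Fder n F α x)
      = opOf n (PP n U V W a b c) F x := by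
  simp only [deriv_deriv_qd]
  rw [deriv_qd]
  unfold opOf PP
  have s : ∀ {T : (Fin n → ℕ) → ℝ → ℝ} (_ : {α | T α ≠ 0}.Finite) (r : ℝ),
      (Function.support fun α => T α x * r * Fder n F α x).Finite := by
    intro T hT r
    have := supp_fin hT x (fun α => r * Fder n F α x)
    simpa only [mul_assoc] using this
  rw [← finsum_add_distrib (s hU _) (s hV _), ← finsum_add_distrib _ (s hW _)]
  · simp only [add_mul]
  · refine ((s hU (qd a b c x)).union (s hV (qd b (2 * c) 0 x))).subset ?_
    exact Function.support_add _ _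

lemma antider (u : ℝ → ℝ) (hu : ContDiff ℝ (⊤ : ℕ∞) u) (x : ℝ) :
    HasDerivAt (fun x => ∫ t in (0 : ℝ)..x, u t) (u x) x :=
  hu.continuous.integral_hasStrictDerivAt 0 x |>.hasDerivAt

lemma antider_smooth (u : ℝ → ℝ) (hu : ContDiff ℝ (⊤ : ℕ∞) u) :
    ContDiff ℝ (⊤ : ℕ∞) (fun x => ∫ t in (0 : ℝ)..x, u t) := by
  rw [contDiff_infty_iff_deriv]
  refine ⟨fun x => (antider u hu x).differentiableAt, ?_⟩
  have : deriv (fun x => ∫ t in (0 : ℝ)..x, u t) = u := funext fun x => (antider u hu x).deriv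
  rw [this]; exact hu

lemma const_of (f : ℝ → ℝ) (h : ∀ x, HasDerivAt f 0 x) (x : ℝ) : f x = f 0 :=
  is_const_of_deriv_eq_zero (fun x => (h x).differentiableAt) (fun x => (h x).deriv) x 0

/-- Lemma 2.1, first part: a 1-cocycle of the general form
`c(X_h,F) = Σ U_α h F^{(α)} + Σ V_α h' F^{(α)} + Σ W_α h'' F^{(α)}` is, up to the
coboundary of some operator `b(F) = Σ D_α F^{(α)}`, of the form
`Σ B_α h' F^{(α)} + Σ C_α h'' F^{(α)}` with constants `B_α, C_α` satisfying
`2(δ−|α|−1) C_α + Σᵢ (αᵢ+1)(αᵢ+2λᵢ) B_{αⁱ} = 0`. -/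
theorem cocycle_normal_form (n : ℕ) (hn : 1 ≤ n) (lam : Fin n → ℝ) (μ : ℝ)
    (U V W : (Fin n → ℕ) → ℝ → ℝ)
    (hUfin : {α | U α ≠ 0}.Finite) (hVfin : {α | V α ≠ 0}.Finite)
    (hWfin : {α | W α ≠ 0}.Finite)
    (hUs : ∀ α, ContDiff ℝ (⊤ : ℕ∞) (U α)) (hVs : ∀ α, ContDiff ℝ (⊤ : ℕ∞) (V α))
    (hWs : ∀ α, ContDiff ℝ (⊤ : ℕ∞) (W α))
    (c : (ℝ → ℝ) → (Fin n → ℝ → ℝ) → ℝ → ℝ)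
    (hc : ∀ h F x, c h F x
        = (∑ᶠ α : Fin n → ℕ, U α x * h x * Fder n F α x)
        + (∑ᶠ α : Fin n → ℕ, V α x * deriv h x * Fder n F α x)
        + (∑ᶠ α : Fin n → ℕ, W α x * deriv (deriv h) x * Fder n F α x))
    (hcoc : IsCocycle n lam μ c) :
    ∃ (D : (Fin n → ℕ) → ℝ → ℝ) (B C : (Fin n → ℕ) → ℝ),
      {α | D α ≠ 0}.Finite ∧ (∀ α, ContDiff ℝ (⊤ : ℕ∞) (D α)) ∧
      (Function.support B).Finite ∧ (Function.support C).Finite ∧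
      (∀ α : Fin n → ℕ,
        2 * ((μ - ∑ i, lam i) - (∑ i, (α i : ℝ)) - 1) * C α
          + ∑ i, ((α i : ℝ) + 1) * ((α i : ℝ) + 2 * lam i)
              * B (Function.update α i (α i + 1)) = 0) ∧
      ∀ h : ℝ → ℝ, IsSl2 h → ∀ F : Fin n → ℝ → ℝ, (∀ i, ContDiff ℝ (⊤ : ℕ∞) (F i)) → ∀ x : ℝ,
        c h F x - cobound n lam μ D h F x
          = (∑ᶠ α : Fin n → ℕ, B α * deriv h x * Fder n F α x)
          + (∑ᶠ α : Fin n → ℕ, C α * deriv (deriv h) x * Fder n F α x) := by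
  have hU : Good n U := ⟨hUfin, hUs⟩
  have hV : Good n V := ⟨hVfin, hVs⟩
  have hW : Good n W := ⟨hWfin, hWs⟩
  have hPg := PP_good n hU hV hW
  have cP : ∀ a b d, c (qd a b d) = fun G y => opOf n (PP n U V W a b d) G y := by
    intro a b d
    funext G y
    rw [hc, c_opOf n hUfin hVfin hWfin]
  have key : ∀ a b d a₂ b₂ d₂ α x,
      PP n U V W (a * b₂ - b * a₂) (2 * (a * d₂ - d * a₂)) (b * d₂ - d * b₂) α x
        = QQ n lam μ a b d (PP n U V W a₂ b₂ d₂) α x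
          - QQ n lam μ a₂ b₂ d₂ (PP n U V W a b d) α x := by
    intro a b d a₂ b₂ d₂ α x
    refine coeff_unique n (Q := fun α x => QQ n lam μ a b d (PP n U V W a₂ b₂ d₂) α x
          - QQ n lam μ a₂ b₂ d₂ (PP n U V W a b d) α x) x (fun F hF => ?_) α
    rw [opOf_sub n (QQ_fin n lam μ a b d (hPg a₂ b₂ d₂).fin)
      (QQ_fin n lam μ a₂ b₂ d₂ (hPg a b d).fin),
      ← act_opOf n lam μ a b d (hPg a₂ b₂ d₂) F hF, ← act_opOf n lam μ a₂ b₂ d₂ (hPg a b d) F hF,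
      ← cP, ← cP]
    have h := hcoc (qd a b d) (qd a₂ b₂ d₂) ⟨a, b, d, rfl⟩ ⟨a₂, b₂, d₂, rfl⟩ F hF x
    rw [← h]
    have e : (fun y => qd a b d y * deriv (qd a₂ b₂ d₂) y - deriv (qd a b d) y * qd a₂ b₂ d₂ y)
        = qd (a * b₂ - b * a₂) (2 * (a * d₂ - d * a₂)) (b * d₂ - d * b₂) := by
      funext y
      simp only [deriv_qd, qd]
      ring
    rw [e, cP]
  have hdU : ∀ α x, HasDerivAt (U α) (deriv (U α) x) x := fun α x =>
    ((hUs α).differentiable (by simp) x).hasDerivAt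
  have hdV : ∀ α x, HasDerivAt (V α) (deriv (V α) x) x := fun α x =>
    ((hVs α).differentiable (by simp) x).hasDerivAt
  have hdW : ∀ α x, HasDerivAt (W α) (deriv (W α) x) x := fun α x =>
    ((hWs α).differentiable (by simp) x).hasDerivAt
  have hdP : ∀ a b d α x, deriv (PP n U V W a b d α) x
      = deriv (U α) x * qd a b d x + U α x * qd b (2 * d) 0 x
        + (deriv (V α) x * qd b (2 * d) 0 x + V α x * (2 * d)) + deriv (W α) x * (2 * d) := by
    intro a b d α x
    have h := ((((hdU α x).mul (qd_hasDerivAt a b d x)).add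
      ((hdV α x).mul (qd_hasDerivAt b (2 * d) 0 x))).add ((hdW α x).mul_const (2 * d))).deriv
    refine Eq.trans h ?_
    simp only [qd]
    ring
  have k1 : ∀ α x, deriv (V α) x = ((μ - ∑ i, lam i) - ∑ i, (α i : ℝ)) * U α x := by
    intro α x
    have h := key 1 0 0 0 1 0 α x
    simp only [QQ, hdP] at h
    simp only [PP, qd] at h
    linarith
  have LU : ∀ α x, LL n lam (PP n U V W 1 0 0) α x = LL n lam U α x := by
    intro α x
    simp [LL, PP, qd]
  have k2 : ∀ α x, deriv (W α) x = - (1 / 2) * LL n lam U α x := by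
    intro α x
    have h := key 1 0 0 0 0 1 α x
    simp only [QQ, hdP, LU] at h
    simp only [PP, qd, k1] at h
    linarith
  have LV : ∀ α, LL n lam (PP n U V W 0 1 0) α 0 = LL n lam V α 0 := by
    intro α
    simp [LL, PP, qd]
  have k3 : ∀ α, 2 * W α 0 = ((μ - ∑ i, lam i) - ∑ i, (α i : ℝ)) * (2 * W α 0)
      + LL n lam V α 0 := by
    intro α
    have h := key 0 1 0 0 0 1 α 0
    simp only [QQ, hdP, LV] at h
    simp only [PP, qd] at h
    linarith
  set D : (Fin n → ℕ) → ℝ → ℝ := fun α x => ∫ t in (0 : ℝ)..x, U α t with hD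
  have hDd : ∀ α x, HasDerivAt (D α) (U α x) x := fun α x => antider (U α) (hUs α) x
  have hD0 : ∀ α, D α 0 = 0 := fun α => by simp [hD]
  have hDg : Good n D := by
    refine ⟨hUfin.subset fun α hα h0 => hα ?_, fun α => antider_smooth _ (hUs α)⟩
    funext x
    simp [hD, h0]
  have hLd : ∀ α x, HasDerivAt (LL n lam D α) (LL n lam U α x) x := by
    intro α x
    exact HasDerivAt.fun_sum fun i _ => (hDd _ x).const_mul _
  have hL0 : ∀ α, LL n lam D α 0 = 0 := fun α => by simp [LL, hD0]
  have hB : ∀ α x, V α x - ((μ - ∑ i, lam i) - ∑ i, (α i : ℝ)) * D α x = V α 0 := by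
    intro α x
    have h := const_of (fun x => V α x - ((μ - ∑ i, lam i) - ∑ i, (α i : ℝ)) * D α x)
      (fun y => ((hdV α y).sub ((hDd α y).const_mul _)).congr_deriv (by rw [k1]; ring)) x
    simpa [hD0] using h
  have hC : ∀ α x, W α x + 1 / 2 * LL n lam D α x = W α 0 := by
    intro α x
    have h := const_of (fun x => W α x + 1 / 2 * LL n lam D α x)
      (fun y => ((hdW α y).add ((hLd α y).const_mul _)).congr_deriv (by rw [k2]; ring)) x
    simpa [hL0] using h
  refine ⟨D, fun α => V α 0, fun α => W α 0, hDg.fin, hDg.smooth, ?_, ?_, ?_, ?_⟩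
  · exact hVfin.subset fun α hα h0 => hα (by simp [h0])
  · exact hWfin.subset fun α hα h0 => hα (by simp [h0])
  · intro α
    have h := k3 α
    simp only [LL] at h
    linarith
  · rintro h ⟨a, b, d, rfl⟩ F hF x
    change c (qd a b d) F x - cobound n lam μ D (qd a b d) F x
      = (∑ᶠ α : Fin n → ℕ, V α 0 * deriv (qd a b d) x * Fder n F α x)
        + (∑ᶠ α : Fin n → ℕ, W α 0 * deriv (deriv (qd a b d)) x * Fder n F α x)
    have e := c_opOf n (U := fun _ _ => 0) (V := fun α _ => V α 0) (W := fun α _ => W α 0)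
      (by
        have : {α : Fin n → ℕ | (fun _ : ℝ => (0 : ℝ)) ≠ 0} = ∅ := by
          ext α
          simp only [Set.mem_ofPred_eq, Set.mem_empty_iff_false, iff_false, not_not]
          rfl
        rw [this]; exact Set.finite_empty)
      (hVfin.subset fun α hα h0 => hα (by funext y; simp [h0]))
      (hWfin.subset fun α hα h0 => hα (by funext y; simp [h0])) a b d F x
    simp only [zero_mul, finsum_zero, zero_add] at e
    rw [e, cP]
    unfold cobound
    rw [act_opOf n lam μ a b d hDg F hF,
      ← opOf_sub n (hPg a b d).fin (QQ_fin n lam μ a b d hDg.fin)]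
    unfold opOf
    apply finsum_congr
    intro α
    congr 1
    simp only [QQ, PP, (hDd α x).deriv, ← hB α x, ← hC α x]
    ring
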